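/- Let X ⊆ V* be a vertex subset admitting a tight perfect matching. Then Σ_{v ∈ X∖B*} p(v) − Σ_{u ∈ X∩B*} p(u) = Σ { q(H) : H ∈ Λ and |X ∩ H| is odd }, i.e., the inequality of the feasibility lemma holds with equality. -/

import Mathlib

open Matrix

/-- A matrix whose row and column index types may differ is *nonsingular* if there is an
index bijection under which its determinant is nonzero.  (This forces the two index sets
to have the same cardinality; the empty matrix is nonsingular by convention.) -/
def Matrix.Nonsing {K : Type*} [CommRing K] {α β : Type*} [Fintype α] [Fintype β]
    [DecidableEq α] (M : Matrix α β K) : Prop :=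
  ∃ e : α ≃ β, (M.submatrix id e).det ≠ 0

/-- The inclusion map between the coercions of two finsets, one contained in the other. -/
def Finset.incl {V : Type*} {P Q : Finset V} (h : P ⊆ Q) (x : ↥P) : ↥Q := ⟨x.1, h x.2⟩

/-- The submatrix `C[X] = C[X ∩ B, X ∖ B]` of a matrix `C` with row set `B` and column
set `V ∖ B`. -/
def csub {K W : Type*} [CommRing K] [Fintype W] [DecidableEq W] (Bs : Finset W)
    (Cs : Matrix ↥Bs ↥(Bsᶜ) K) (X : Finset W) : Matrix ↥(X ∩ Bs) ↥(X \ Bs) K :=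
  Cs.submatrix (Finset.incl Finset.inter_subset_right)
    (Finset.incl (by intro a ha; exact Finset.mem_compl.mpr (Finset.mem_sdiff.mp ha).2))

/-- The pair `(u, v)` of distinct vertices *crosses* the set `Hi` if exactly one of
`u, v` belongs to `Hi`. -/
def crosses {W : Type*} [DecidableEq W] (Hi : Finset W) (u v : W) : Prop :=
  (u ∈ Hi ∧ v ∉ Hi) ∨ (v ∈ Hi ∧ u ∉ Hi)

instance {W : Type*} [DecidableEq W] (Hi : Finset W) (u v : W) :
    Decidable (crosses Hi u v) :=
  inferInstanceAs (Decidable ((u ∈ Hi ∧ v ∉ Hi) ∨ (v ∈ Hi ∧ u ∉ Hi)))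

/-- `Q_{uv}`: the sum of `q (H i)` over all blossoms `H i` crossed by the pair
`(u, v)`. -/
def Qsum {W I : Type*} [DecidableEq W] [Fintype I] (H : I → Finset W) (q : I → ℝ)
    (u v : W) : ℝ :=
  ∑ i ∈ Finset.univ.filter (fun i => crosses (H i) u v), q i

/-- Dual feasibility condition (DF2): `p v − p u ≥ Q_{uv}` for every `(u, v) ∈ F*`,
i.e. for every `u ∈ B*`, `v ∈ V* ∖ B*` with `C*_{uv} ≠ 0`. -/
def DF2 {K W I : Type*} [Field K] [Fintype W] [DecidableEq W] [Fintype I]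
    (Bs : Finset W) (Cs : Matrix ↥Bs ↥(Bsᶜ) K) (H : I → Finset W) (q : I → ℝ)
    (p : W → ℝ) : Prop :=
  ∀ (u : ↥Bs) (v : ↥(Bsᶜ)), Cs u v ≠ 0 → Qsum H q u.1 v.1 ≤ p v.1 - p u.1

/-- `M` is a perfect matching of the vertex set `X`: a bijection between `X ∩ B*` and
`X ∖ B*` such that `C*_{u, M u} ≠ 0` for every `u`. -/
def IsPM {K W : Type*} [Field K] [Fintype W] [DecidableEq W] (Bs : Finset W)
    (Cs : Matrix ↥Bs ↥(Bsᶜ) K) (X : Finset W)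
    (M : ↥(X ∩ Bs) ≃ ↥(X \ Bs)) : Prop :=
  ∀ u, csub Bs Cs X u (M u) ≠ 0

/-- `M` is a *tight* perfect matching of `X`: a perfect matching all of whose edges
`(u, M u)` are tight (`p (M u) − p u = Q_{u, M u}`) and which is consistent with every
blossom `H i` with `q i > 0` (at most one matching edge crosses `H i`). -/
def IsTightPM {K W I : Type*} [Field K] [Fintype W] [DecidableEq W] [Fintype I]
    (Bs : Finset W) (Cs : Matrix ↥Bs ↥(Bsᶜ) K) (H : I → Finset W) (q : I → ℝ)
    (p : W → ℝ) (X : Finset W) (M : ↥(X ∩ Bs) ≃ ↥(X \ Bs)) : Prop :=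
  IsPM Bs Cs X M ∧
  (∀ u, p ((M u : ↥(X \ Bs)) : W) - p ((u : ↥(X ∩ Bs)) : W) =
      Qsum H q ((u : ↥(X ∩ Bs)) : W) ((M u : ↥(X \ Bs)) : W)) ∧
  (∀ i, 0 < q i →
    (Finset.univ.filter (fun u : ↥(X ∩ Bs) =>
        crosses (H i) ((u : ↥(X ∩ Bs)) : W) ((M u : ↥(X \ Bs)) : W))).card ≤ 1)

/-- Summing over `X ∖ B` amounts to summing over the partners of the vertices of `X ∩ B`. -/
theorem sum_sdiff_eq_sum_equiv {W A : Type*} [DecidableEq W] [AddCommMonoid A]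
    (Bs X : Finset W) (M : ↥(X ∩ Bs) ≃ ↥(X \ Bs)) (f : W → A) :
    ∑ v ∈ X \ Bs, f v = ∑ u : ↥(X ∩ Bs), f (M u : W) := by
  rw [← Finset.sum_coe_sort (X \ Bs) f]
  exact (M.sum_comp fun v : ↥(X \ Bs) => f v).symm

/-- The number of matching edges crossing `S` has the same parity as `|X ∩ S|`. -/
theorem odd_card_inter_iff_odd_card_crosses {W : Type*} [DecidableEq W]
    (Bs X S : Finset W) (M : ↥(X ∩ Bs) ≃ ↥(X \ Bs)) :
    Odd (X ∩ S).card ↔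
      Odd (Finset.univ.filter fun u : ↥(X ∩ Bs) => crosses S (u : W) (M u : W)).card := by
  have hcard : (((X ∩ S).card : ℕ) : ZMod 2) =
      ((Finset.univ.filter fun u : ↥(X ∩ Bs) => crosses S (u : W) (M u : W)).card : ℕ) := by
    rw [← Finset.filter_mem_eq_inter, Finset.natCast_card_filter, Finset.natCast_card_filter,
      ← Finset.sum_inter_add_sum_sdiff X Bs, sum_sdiff_eq_sum_equiv Bs X M,
      ← Finset.sum_coe_sort (X ∩ Bs), ← Finset.sum_add_distrib]
    refine Finset.sum_congr rfl fun u _ => ?_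
    by_cases hu : (u : W) ∈ S <;> by_cases hv : (M u : W) ∈ S <;>
      simp [crosses, hu, hv, CharTwo.add_self_eq_zero]
  rw [← ZMod.natCast_eq_one_iff_odd, ← ZMod.natCast_eq_one_iff_odd, hcard]

/-- **Tight perfect matchings attain the feasibility inequality with equality.**
Let `X ⊆ V*` be a vertex subset admitting a tight perfect matching (with `q ≥ 0`).  Then
`Σ_{v ∈ X∖B*} p v − Σ_{u ∈ X∩B*} p u = Σ { q H : H ∈ Λ, |X ∩ H| odd }`. -/
theorem tightPM_p_diff_eq_qsum_odd {K W I : Type*} [Field K] [Fintype W] [DecidableEq W]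
    [Fintype I]
    (Bs : Finset W) (Cs : Matrix ↥Bs ↥(Bsᶜ) K)
    (H : I → Finset W) (q : I → ℝ) (hq : ∀ i, 0 ≤ q i) (p : W → ℝ)
    (X : Finset W) (M : ↥(X ∩ Bs) ≃ ↥(X \ Bs))
    (hM : IsTightPM Bs Cs H q p X M) :
    ∑ v ∈ X \ Bs, p v - ∑ u ∈ X ∩ Bs, p u =
      ∑ i ∈ Finset.univ.filter (fun i => Odd ((X ∩ H i).card)), q i := by
  obtain ⟨-, htight, hcons⟩ := hM
  rw [sum_sdiff_eq_sum_equiv Bs X M, ← Finset.sum_coe_sort (X ∩ Bs), ← Finset.sum_sub_distrib,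
    Finset.sum_congr rfl fun u _ => htight u]
  simp only [Qsum, Finset.sum_filter]
  rw [Finset.sum_comm]
  refine Finset.sum_congr rfl fun i _ => ?_
  rw [← Finset.sum_filter, Finset.sum_const, nsmul_eq_mul]
  rcases (hq i).eq_or_lt with h0 | hpos
  · simp [← h0]
  · simp only [odd_card_inter_iff_odd_card_crosses Bs X (H i) M]
    have hle := hcons i hpos
    generalize Finset.card _ = n at hle ⊢
    interval_cases n <;> simp
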